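/- arXiv:2412.05017 — 2 statements merged into one kernel-verified Lean document; each statement's English description precedes it below -/
import Mathlib

section
/- Let a_1,…,a_n be positive integers with Σ_{i=1}^n a_i = 2C. If there exists a feasible solution to DLSPp whose cost is at most n + C, then there exists a subset A ⊆ {1,…,n} with Σ_{i∈A} a_i = C = Σ_{i∉A} a_i. -/
/-- Core level `J i` determined by returns `R` and remanufacturing decisions `x`:
`J 1 = R 1`, `J (i+1) = J i + R (i+1) - x i`. -/
def coreLevel (R x : ℕ → ℤ) : ℕ → ℤ
  | 0 => 0
  | 1 => R 1
  | (i + 2) => coreLevel R x (i + 1) + R (i + 2) - x (i + 1)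

/-- Serviceable inventory level `I i`: `I 1 = 0`, `I (i+1) = I i + x i + y i - D i`. -/
def servLevel (D x y : ℕ → ℤ) : ℕ → ℤ
  | 0 => 0
  | 1 => 0
  | (i + 2) => servLevel D x y (i + 1) + x (i + 1) + y (i + 1) - D (i + 1)

/-- Feasibility of `(x, y)` for the dynamic lot sizing problem with `N` periods,
demands `D` and returns `R`. -/
def Feasible (N : ℕ) (D R x y : ℕ → ℤ) : Prop :=
  ∀ i : ℕ, 1 ≤ i → i ≤ N →
    0 ≤ x i ∧ 0 ≤ y i ∧ x i ≤ coreLevel R x i ∧ 0 ≤ servLevel D x y (i + 1)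

/-- Total cost of a solution `(x, y)` of the dynamic lot sizing problem. -/
def cost (N : ℕ) (D R Kr Km hs hc cr cm x y : ℕ → ℤ) : ℤ :=
  ∑ i ∈ Finset.Icc 1 N,
    (Kr i * (if 0 < x i then 1 else 0) + Km i * (if 0 < y i then 1 else 0)
      + cr i * x i + cm i * y i + hc i * (coreLevel R x i - x i)
      + hs i * servLevel D x y (i + 1))

/-- Returns for the DLSPp instance: `R 1 = C`, `R i = 0` for `i ≠ 1`. -/
def ppR (C : ℤ) : ℕ → ℤ := fun i => if i = 1 then C else 0

theorem coreLevel_succ_ppR (C : ℤ) (x : ℕ → ℤ) (m : ℕ) :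
    coreLevel (ppR C) x (m + 1) = C - ∑ i ∈ Finset.Icc 1 m, x i := by
  induction m with
  | zero => simp [coreLevel, ppR]
  | succ k ih =>
    rw [Finset.sum_Icc_succ_top (by omega), coreLevel, ih]
    simp only [ppR, if_neg (show k + 2 ≠ 1 by omega)]
    ring

theorem servLevel_succ_eq_sum (D x y : ℕ → ℤ) (m : ℕ) :
    servLevel D x y (m + 1) = ∑ i ∈ Finset.Icc 1 m, x i + ∑ i ∈ Finset.Icc 1 m, y i
      - ∑ i ∈ Finset.Icc 1 m, D i := by
  induction m with
  | zero => simp [servLevel]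
  | succ k ih =>
    simp only [Finset.sum_Icc_succ_top (show 1 ≤ k + 1 by omega)]
    rw [servLevel, ih]
    ring

theorem servLevel_succ (D x y : ℕ → ℤ) {i : ℕ} (hi : 1 ≤ i) :
    servLevel D x y (i + 1) = servLevel D x y i + x i + y i - D i := by
  obtain ⟨k, rfl⟩ := Nat.exists_eq_add_of_le' hi
  rfl

theorem sum_servLevel_succ (D x y : ℕ → ℤ) (m : ℕ) :
    ∑ i ∈ Finset.Icc 1 m, servLevel D x y (i + 1)
      = ∑ i ∈ Finset.Icc 1 m, servLevel D x y i + servLevel D x y (m + 1) := by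
  induction m with
  | zero => simp [servLevel]
  | succ k ih =>
    simp only [Finset.sum_Icc_succ_top (show 1 ≤ k + 1 by omega)]
    rw [ih]

theorem Feasible.servLevel_nonneg {N : ℕ} {D R x y : ℕ → ℤ} (h : Feasible N D R x y) {i : ℕ}
    (hi : i ≤ N + 1) : 0 ≤ servLevel D x y i := by
  match i with
  | 0 => simp [servLevel]
  | 1 => simp [servLevel]
  | k + 2 => exact (h (k + 1) (by omega) (by omega)).2.2.2

/-- If some feasible solution to DLSPp has cost at most `n + C`, then the partition
instance has a solution. -/
theorem stmt2 (n : ℕ) (hn : 1 ≤ n) (a : ℕ → ℤ) (C : ℤ)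
    (ha : ∀ i : ℕ, 1 ≤ i → i ≤ n → 0 < a i)
    (hsum : ∑ i ∈ Finset.Icc 1 n, a i = 2 * C)
    (x y : ℕ → ℤ) (hfeas : Feasible n a (ppR C) x y)
    (hcost : cost n a (ppR C) (fun _ => 1) (fun _ => 1) (fun _ => 3) (fun _ => 0)
        (fun _ => 0) (fun _ => 1) x y ≤ (n : ℤ) + C) :
    ∃ A : Finset ℕ, A ⊆ Finset.Icc 1 n ∧
      ∑ i ∈ A, a i = C ∧ ∑ i ∈ Finset.Icc 1 n \ A, a i = C := by
  have hcore := (hfeas n hn le_rfl).2.2.1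
  obtain ⟨m, rfl⟩ := Nat.exists_eq_add_of_le' hn
  rw [coreLevel_succ_ppR] at hcore
  have hx : ∑ i ∈ Finset.Icc 1 (m + 1), x i ≤ C := by
    rw [Finset.sum_Icc_succ_top (by omega)]
    linarith
  have hlast := servLevel_succ_eq_sum a x y (m + 1)
  have hlast0 : 0 ≤ servLevel a x y (m + 1 + 1) := hfeas.servLevel_nonneg le_rfl
  -- The holding cost of a period is charged to the next one.
  set f : ℕ → ℤ := fun i =>
    (if 0 < x i then 1 else 0) + (if 0 < y i then 1 else 0) + 3 * servLevel a x y i - 1 with hf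
  have hf0 : ∀ i ∈ Finset.Icc 1 (m + 1), 0 ≤ f i := by
    intro i hi
    obtain ⟨h1, h2⟩ := Finset.mem_Icc.mp hi
    obtain ⟨hxi, hyi, -, hs⟩ := hfeas i h1 h2
    have hI : 0 ≤ servLevel a x y i := hfeas.servLevel_nonneg (by omega)
    have hai := ha i h1 h2
    rw [servLevel_succ a x y h1] at hs
    simp only [hf]
    split_ifs <;> omega
  have hsumf : cost (m + 1) a (ppR C) (fun _ => 1) (fun _ => 1) (fun _ => 3) (fun _ => 0)
      (fun _ => 0) (fun _ => 1) x y = ∑ i ∈ Finset.Icc 1 (m + 1), f i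
        + ∑ i ∈ Finset.Icc 1 (m + 1), y i + 3 * servLevel a x y (m + 1 + 1) + ((m + 1 : ℕ) : ℤ) := by
    have hshift := sum_servLevel_succ a x y (m + 1)
    simp only [cost, hf, one_mul, zero_mul, add_zero, Finset.sum_add_distrib,
      Finset.sum_sub_distrib, ← Finset.mul_sum, hshift]
    simp only [Finset.sum_const, Nat.card_Icc]
    push_cast
    simp
    ring
  rw [hsumf] at hcost
  have hnonneg := Finset.sum_nonneg hf0
  have hlast_zero : servLevel a x y (m + 1 + 1) = 0 := by linarith
  have hsy : ∑ i ∈ Finset.Icc 1 (m + 1), y i = C := by linarith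
  have hfz := (Finset.sum_eq_zero_iff_of_nonneg hf0).mp (by linarith)
  have hserv : ∀ i ∈ Finset.Icc 1 (m + 1), servLevel a x y i = 0 := by
    intro i hi
    have hI : 0 ≤ servLevel a x y i :=
      hfeas.servLevel_nonneg (by have := (Finset.mem_Icc.mp hi).2; omega)
    have h := hfz i hi
    simp only [hf] at h
    split_ifs at h <;> omega
  have hy : ∀ i ∈ Finset.Icc 1 (m + 1), (if 0 < y i then a i else 0) = y i := by
    intro i hi
    obtain ⟨h1, h2⟩ := Finset.mem_Icc.mp hi
    obtain ⟨hxi, hyi, -, -⟩ := hfeas i h1 h2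
    have hrec := servLevel_succ a x y h1
    have hnext : servLevel a x y (i + 1) = 0 := by
      rcases h2.eq_or_lt with rfl | hlt
      · exact hlast_zero
      · exact hserv _ (Finset.mem_Icc.mpr ⟨by omega, hlt⟩)
    have h := hfz i hi
    have hz := hserv i hi
    simp only [hf] at h
    split_ifs at h ⊢ <;> omega
  have hA : ∑ i ∈ Finset.Icc 1 (m + 1) with 0 < y i, a i = C := by
    rw [Finset.sum_filter, Finset.sum_congr rfl hy, hsy]
  refine ⟨_, Finset.filter_subset _ _, hA, ?_⟩
  have := Finset.sum_sdiff (f := a)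
    (Finset.filter_subset (fun i => 0 < y i) (Finset.Icc 1 (m + 1)))
  linarith
end

section
/- Consider a DLSP whose parameters satisfy Assumption 1, and let (x*, y*) be an optimal solution with associated serviceable inventory levels I*. If production occurs in the i-th period for some 1 ≤ i ≤ N − 1 (that is, x*_i + y*_i ≥ 1) and I*_i = 0, then x*_i + y*_i = D_i. -/
/-- Postpone `a` units of the production plan `z` from period `i` to period `i + 1`. -/
def postpone (i : ℕ) (a : ℤ) (z : ℕ → ℤ) (j : ℕ) : ℤ :=
  z j + (if j = i then -a else 0) + (if j = i + 1 then a else 0)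

theorem coreLevel_postpone (R x : ℕ → ℤ) (a : ℤ) {i : ℕ} (hi : 1 ≤ i) :
    ∀ j, coreLevel R (postpone i a x) j = coreLevel R x j + if j = i + 1 then a else 0
  | 0 => by simp [coreLevel]
  | 1 => by
    have : i ≠ 0 := by omega
    simp [coreLevel, this]
  | j + 2 => by
    simp only [coreLevel, coreLevel_postpone R x a hi (j + 1), postpone]
    split_ifs <;> omega

theorem servLevel_postpone (D x y : ℕ → ℤ) (a b : ℤ) {i : ℕ} (hi : 1 ≤ i) :
    ∀ j, servLevel D (postpone i a x) (postpone i b y) j =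
      servLevel D x y j - if j = i + 1 then a + b else 0
  | 0 => by simp [servLevel]
  | 1 => by
    have : i ≠ 0 := by omega
    simp [servLevel, this]
  | j + 2 => by
    simp only [servLevel, servLevel_postpone D x y a b hi (j + 1), postpone]
    split_ifs <;> omega

theorem Feasible.postpone {N : ℕ} {D R x y : ℕ → ℤ} (h : Feasible N D R x y) {a b : ℤ}
    (ha : 0 ≤ a) (hb : 0 ≤ b) {i : ℕ} (hi : 1 ≤ i) (hax : a ≤ x i) (hby : b ≤ y i)
    (hab : a + b ≤ servLevel D x y (i + 1)) :
    Feasible N D R (postpone i a x) (postpone i b y) := by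
  intro j hj hjN
  obtain ⟨h₁, h₂, h₃, h₄⟩ := h j hj hjN
  rw [coreLevel_postpone R x a hi, servLevel_postpone D x y a b hi]
  simp only [_root_.postpone]
  by_cases hji : j = i
  · subst hji
    simp
    omega
  · by_cases hji' : j = i + 1
    · subst hji'
      simp
      omega
    · simp [hji, hji', h₁, h₂, h₃, h₄]

theorem sum_Icc_lt_of_consecutive {N i : ℕ} {f g : ℕ → ℤ} (hi : 1 ≤ i) (hiN : i + 1 ≤ N)
    (heq : ∀ j, j ≠ i → j ≠ i + 1 → f j = g j) (hlt : f i + f (i + 1) < g i + g (i + 1)) :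
    ∑ j ∈ Finset.Icc 1 N, f j < ∑ j ∈ Finset.Icc 1 N, g j := by
  have h₁ : i ∈ Finset.Icc 1 N := by simp; omega
  have h₂ : i + 1 ∈ (Finset.Icc 1 N).erase i := by simp; omega
  rw [← Finset.add_sum_erase _ f h₁, ← Finset.add_sum_erase _ f h₂,
    ← Finset.add_sum_erase _ g h₁, ← Finset.add_sum_erase _ g h₂]
  have h₃ : ∑ j ∈ ((Finset.Icc 1 N).erase i).erase (i + 1), f j =
      ∑ j ∈ ((Finset.Icc 1 N).erase i).erase (i + 1), g j := by
    refine Finset.sum_congr rfl fun j hj => heq j ?_ ?_ <;> simp at hj <;> tauto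
  linarith

/-- Lowering a quantity never raises its setup charge. -/
theorem setup_sub_le {K z a : ℤ} (hK : 0 ≤ K) (ha : 0 ≤ a) :
    K * (if 0 < z + -a then 1 else 0) ≤ K * (if 0 < z then 1 else 0) := by
  split_ifs <;> omega

/-- Raising a quantity by `1` raises its setup charge by at most `K`. -/
theorem setup_add_one_le {K z : ℤ} (hK : 0 ≤ K) :
    K * (if 0 < z + 1 then 1 else 0) ≤ K * (if 0 < z then 1 else 0) + K := by
  split_ifs <;> simp [hK]

/-- For a DLSP satisfying Assumption 1, if an optimal solution produces in period `i`
with `1 ≤ i ≤ N - 1` and `I*_i = 0`, then `x*_i + y*_i = D_i`. -/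
theorem stmt5 (N : ℕ) (hN : 1 ≤ N) (D R Kr Km hs hc cr cm : ℕ → ℤ)
    (hD : ∀ i : ℕ, 1 ≤ i → i ≤ N → 0 < D i)
    (hR : ∀ i : ℕ, 1 ≤ i → i ≤ N → 0 ≤ R i)
    (hKr : ∀ i : ℕ, 1 ≤ i → i ≤ N → 0 ≤ Kr i)
    (hKm : ∀ i : ℕ, 1 ≤ i → i ≤ N → 0 ≤ Km i)
    (hhs : ∀ i : ℕ, 1 ≤ i → i ≤ N → 0 ≤ hs i)
    (hhc : ∀ i : ℕ, 1 ≤ i → i ≤ N → 0 ≤ hc i)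
    (hcr : ∀ i : ℕ, 1 ≤ i → i ≤ N → 0 ≤ cr i)
    (hcm : ∀ i : ℕ, 1 ≤ i → i ≤ N → 0 ≤ cm i)
    (hRN : R (N + 1) = 0) (hKrN : Kr (N + 1) = 0) (hKmN : Km (N + 1) = 0)
    (hcrN : cr (N + 1) = 0) (hcmN : cm (N + 1) = 0)
    (hass1 : ∀ i : ℕ, 1 ≤ i → i ≤ N → Km (i + 1) + cm (i + 1) < hs i + cm i)
    (hass2 : ∀ i : ℕ, 1 ≤ i → i ≤ N → Kr (i + 1) + hc i + cr (i + 1) < hs i + cr i)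
    (x y : ℕ → ℤ)
    (hfeas : Feasible N D R x y)
    (hopt : ∀ x' y' : ℕ → ℤ, Feasible N D R x' y' →
      cost N D R Kr Km hs hc cr cm x y ≤ cost N D R Kr Km hs hc cr cm x' y')
    (i : ℕ) (hi1 : 1 ≤ i) (hi2 : i ≤ N - 1)
    (hprod : 1 ≤ x i + y i) (hIi : servLevel D x y i = 0) :
    x i + y i = D i := by
  have hiN : i + 1 ≤ N := by omega
  by_contra hne
  have hpos := (hfeas i hi1 (by omega)).2.2.2
  have hsucc := servLevel_succ D x y hi1
  obtain ⟨hx, hy, -, -⟩ := hfeas i hi1 (by omega)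
  have hI : 1 ≤ servLevel D x y (i + 1) := by omega
  by_cases hyi : 1 ≤ y i
  · refine absurd (hopt _ _ (hfeas.postpone (a := 0) (b := 1) le_rfl zero_le_one hi1 hx hyi
      (by simpa using hI))) (not_le.mpr ?_)
    refine sum_Icc_lt_of_consecutive hi1 hiN (fun j hj hj' => ?_) ?_
    · simp [coreLevel_postpone R x 0 hi1, servLevel_postpone D x y 0 1 hi1, postpone, hj, hj']
    · simp only [coreLevel_postpone R x 0 hi1, servLevel_postpone D x y 0 1 hi1, postpone]
      have h₁ := setup_sub_le (z := y i) (hKm i hi1 (by omega)) zero_le_one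
      have h₂ := setup_add_one_le (z := y (i + 1)) (hKm (i + 1) (by omega) hiN)
      have h₃ := hass1 i hi1 (by omega)
      simp
      simp at h₁ h₂
      linarith
  · refine absurd (hopt _ _ (hfeas.postpone (a := 1) (b := 0) zero_le_one le_rfl hi1 (by omega) hy
      (by simpa using hI))) (not_le.mpr ?_)
    refine sum_Icc_lt_of_consecutive hi1 hiN (fun j hj hj' => ?_) ?_
    · simp [coreLevel_postpone R x 1 hi1, servLevel_postpone D x y 1 0 hi1, postpone, hj, hj']
    · simp only [coreLevel_postpone R x 1 hi1, servLevel_postpone D x y 1 0 hi1, postpone]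
      have h₁ := setup_sub_le (z := x i) (hKr i hi1 (by omega)) zero_le_one
      have h₂ := setup_add_one_le (z := x (i + 1)) (hKr (i + 1) (by omega) hiN)
      have h₃ := hass2 i hi1 (by omega)
      simp
      simp at h₁ h₂
      linarith
end
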